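/- (Proposition 3, unbiasedness of the repeatability variance estimate.) Let a, b > 0 be real numbers, let n ≥ 2 and L ≥ 1 be natural numbers, and let X₁,…,X_L be random variables on a probability space, each distributed according to the beta-binomial distribution BBi(n,a,b). With p̂ᵢ = Xᵢ/n, the estimator σ̂_r² = (n / (L(n−1))) · Σᵢ₌₁^L p̂ᵢ(1 − p̂ᵢ) satisfies E[σ̂_r²] = a·b/((a+b)(a+b+1)) = σ_r²; that is, σ̂_r² is an unbiased estimate of the repeatability variance. -/

import Mathlib

open MeasureTheory

/-- The Beta function `B(a,b) = ∫₀¹ t^(a-1) (1-t)^(b-1) dt`. -/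
noncomputable def betaFun (a b : ℝ) : ℝ :=
  ∫ t in (0:ℝ)..1, t ^ (a - 1) * (1 - t) ^ (b - 1)

/-- The probability mass function of the beta-binomial distribution `BBi(n,a,b)`:
`f(k) = C(n,k)·B(k+a, n-k+b)/B(a,b)` (which vanishes for `k > n`). -/
noncomputable def betaBinPMF (n : ℕ) (a b : ℝ) (k : ℕ) : ℝ :=
  (n.choose k : ℝ) * betaFun ((k : ℝ) + a) ((n : ℝ) - (k : ℝ) + b) / betaFun a b

lemma bf_eq {a b : ℝ} (ha : 0 < a) (hb : 0 < b) :
    betaFun a b = Real.Gamma a * Real.Gamma b / Real.Gamma (a + b) := by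
  have h := ProbabilityTheory.beta_eq_betaIntegralReal a b ha hb
  rw [ProbabilityTheory.beta] at h
  rw [h, Complex.betaIntegral, betaFun, ← Complex.ofReal_re
    (∫ t in (0:ℝ)..1, t ^ (a - 1) * (1 - t) ^ (b - 1)), ← intervalIntegral.integral_ofReal]
  congr 1
  apply intervalIntegral.integral_congr
  intro x hx
  rw [Set.uIcc_of_le zero_le_one] at hx
  have h1 : (0:ℝ) ≤ 1 - x := by linarith [hx.2]
  simp only [Complex.ofReal_mul]
  rw [Complex.ofReal_cpow hx.1, Complex.ofReal_cpow h1]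
  push_cast
  rfl

lemma bf_pos {a b : ℝ} (ha : 0 < a) (hb : 0 < b) : 0 < betaFun a b := by
  rw [bf_eq ha hb]
  have := Real.Gamma_pos_of_pos ha
  have := Real.Gamma_pos_of_pos hb
  have := Real.Gamma_pos_of_pos (add_pos ha hb)
  positivity

lemma bf_left {a b : ℝ} (ha : 0 < a) (hb : 0 < b) :
    betaFun (a + 1) b = a / (a + b) * betaFun a b := by
  rw [bf_eq ha hb, bf_eq (by linarith) hb, show a + 1 + b = (a + b) + 1 by ring,
    Real.Gamma_add_one ha.ne', Real.Gamma_add_one (by positivity)]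
  have := Real.Gamma_pos_of_pos (add_pos ha hb)
  field_simp

lemma bf_right {a b : ℝ} (ha : 0 < a) (hb : 0 < b) :
    betaFun a (b + 1) = b / (a + b) * betaFun a b := by
  rw [bf_eq ha hb, bf_eq ha (by linarith), show a + (b + 1) = (a + b) + 1 by ring,
    Real.Gamma_add_one hb.ne', Real.Gamma_add_one (by positivity)]
  have := Real.Gamma_pos_of_pos (add_pos ha hb)
  field_simp

lemma bf_sum (m : ℕ) {a b : ℝ} (ha : 0 < a) (hb : 0 < b) :
    ∑ ij ∈ Finset.HasAntidiagonal.antidiagonal m, (m.choose ij.1 : ℝ) * betaFun (ij.1 + a) (ij.2 + b)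
      = betaFun a b := by
  induction m with
  | zero => simp
  | succ m ih =>
    rw [Finset.sum_antidiagonal_choose_succ_mul (fun i j => betaFun (i + a) (j + b)) m,
      ← Finset.sum_add_distrib]
    rw [← ih]
    apply Finset.sum_congr rfl
    rintro ⟨i, j⟩ hij
    rw [Finset.HasAntidiagonal.mem_antidiagonal] at hij
    simp only at hij ⊢
    have hc : m.choose j = m.choose i := by
      rw [← hij]; exact Nat.choose_symm_add.symm
    have hi : 0 < (i : ℝ) + a := by positivity
    have hj : 0 < (j : ℝ) + b := by positivity
    rw [hc]
    push_cast
    rw [show (j : ℝ) + 1 + b = (j + b) + 1 by ring, show (i : ℝ) + 1 + a = (i + a) + 1 by ring,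
      bf_left hi hj, bf_right hi hj]
    field_simp
    ring

lemma bf_sum2 (m : ℕ) {a b : ℝ} (ha : 0 < a) (hb : 0 < b) :
    ∑ ij ∈ Finset.HasAntidiagonal.antidiagonal (m + 2), ((m + 2).choose ij.1 : ℝ) * (ij.1 * ij.2) *
        betaFun (ij.1 + a) (ij.2 + b)
      = (m + 2) * (m + 1) * betaFun (a + 1) (b + 1) := by
  rw [Finset.Nat.antidiagonal_succ_succ', ← bf_sum m (a := a + 1) (b := b + 1) (by linarith)
    (by linarith), Finset.mul_sum]
  simp only [Finset.sum_cons, Finset.sum_map]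
  simp only [Nat.cast_zero, mul_zero, zero_mul, zero_add]
  apply Finset.sum_congr rfl
  rintro ⟨i, j⟩ hij
  rw [Finset.HasAntidiagonal.mem_antidiagonal] at hij
  simp only at hij
  have h1 := Nat.add_one_mul_choose_eq (m + 1) i
  have h2 : (m + 1) * m.choose i = (m + 1).choose i * (j + 1) := by
    have h := Nat.choose_mul_succ_eq m i
    rw [show m + 1 - i = j + 1 by omega] at h
    rw [← h, mul_comm]
  have h1' : ((m : ℝ) + 2) * (m + 1).choose i = (m + 2).choose (i + 1) * (i + 1) := by
    have := congrArg (Nat.cast : ℕ → ℝ) h1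
    push_cast at this
    linarith
  have h2' : ((m : ℝ) + 1) * m.choose i = (m + 1).choose i * (j + 1) := by exact_mod_cast h2
  have h3 : ((m + 2).choose (i + 1) : ℝ) * ((i + 1) * (j + 1)) = (m + 2) * (m + 1) * m.choose i := by
    linear_combination (-(j : ℝ) - 1) * h1' - ((m : ℝ) + 2) * h2'
  simp only [Function.Embedding.prodMap, Function.Embedding.coeFn_mk, Prod.map, Nat.succ_eq_add_one]
  push_cast
  rw [h3, show (i : ℝ) + 1 + a = i + (a + 1) by ring, show (j : ℝ) + 1 + b = j + (b + 1) by ring]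
  ring

lemma integral_fin {Ω : Type*} [MeasurableSpace Ω] (P : Measure Ω) [IsProbabilityMeasure P]
    (n : ℕ) (X : Ω → ℕ) (hX : Measurable X) (h0 : ∀ k, n < k → (P (X ⁻¹' {k})).toReal = 0)
    (g : ℕ → ℝ) :
    Integrable (fun ω => g (X ω)) P ∧ ∫ ω, g (X ω) ∂P =
      ∑ k ∈ Finset.range (n + 1), (P (X ⁻¹' {k})).toReal * g k := by
  have hm : ∀ k, MeasurableSet (X ⁻¹' {k}) := fun k => hX (measurableSet_singleton k)
  have hae : ∀ᵐ ω ∂P, ∀ k, n < k → X ω ≠ k := by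
    rw [ae_all_iff]
    intro k
    by_cases hk : n < k
    · have h := (ENNReal.toReal_eq_zero_iff _).1 (h0 k hk)
      have h := h.resolve_right (measure_ne_top _ _)
      filter_upwards [measure_eq_zero_iff_ae_notMem.1 h] with ω hω _
      exact hω
    · exact Filter.Eventually.of_forall fun ω h => absurd h hk
  have heq : (fun ω => g (X ω)) =ᵐ[P] fun ω =>
      ∑ k ∈ Finset.range (n + 1), (X ⁻¹' {k}).indicator (fun _ => g k) ω := by
    filter_upwards [hae] with ω hω
    have hle : X ω < n + 1 := by
      by_contra h
      exact hω (X ω) (by omega) rfl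
    rw [Finset.sum_eq_single (X ω)]
    · simp
    · intro k _ hk
      simp [hk.symm]
    · intro h
      exact absurd (Finset.mem_range.2 hle) h
  have hi : ∀ k ∈ Finset.range (n + 1), Integrable ((X ⁻¹' {k}).indicator (fun _ => g k)) P :=
    fun k _ => (integrable_const _).indicator (hm k)
  refine ⟨(integrable_finsetSum _ hi).congr heq.symm, ?_⟩
  rw [integral_congr_ae heq, integral_finsetSum _ hi]
  apply Finset.sum_congr rfl
  intro k _
  rw [integral_indicator_const _ (hm k)]
  simp [Measure.real]

/-- Proposition 3, unbiasedness of the repeatability variance estimate: if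
`X₁,…,X_L` are each distributed as `BBi(n,a,b)` and `p̂ᵢ = Xᵢ/n`, then the
estimator `σ̂_r² = (n/(L(n-1))) · ∑ᵢ p̂ᵢ(1-p̂ᵢ)` satisfies
`E[σ̂_r²] = a·b/((a+b)(a+b+1)) = σ_r²`. -/
theorem repeatability_estimate_unbiased {Ω : Type*} [MeasurableSpace Ω]
    (P : Measure Ω) [IsProbabilityMeasure P]
    (a b : ℝ) (ha : 0 < a) (hb : 0 < b)
    (n : ℕ) (hn : 2 ≤ n) (L : ℕ) (hL : 1 ≤ L)
    (X : Fin L → Ω → ℕ) (hX : ∀ i, Measurable (X i))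
    (hdist : ∀ i, ∀ k : ℕ, (P (X i ⁻¹' {k})).toReal = betaBinPMF n a b k) :
    ∫ ω, ((n : ℝ) / ((L : ℝ) * ((n : ℝ) - 1)))
        * ∑ i, ((X i ω : ℝ) / (n : ℝ)) * (1 - (X i ω : ℝ) / (n : ℝ)) ∂P
      = a * b / ((a + b) * (a + b + 1)) := by
  have h0 : ∀ i, ∀ k, n < k → (P (X i ⁻¹' {k})).toReal = 0 := by
    intro i k hk
    rw [hdist, betaBinPMF, Nat.choose_eq_zero_of_lt hk]
    simp
  have key := fun i => integral_fin P n (X i) (hX i) (h0 i)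
    (fun k => ((k : ℝ) / n) * (1 - (k : ℝ) / n))
  have hn2 : (2 : ℝ) ≤ n := by exact_mod_cast hn
  have hL1 : (1 : ℝ) ≤ L := by exact_mod_cast hL
  have hE : ∀ i, ∫ ω, ((X i ω : ℝ) / n) * (1 - (X i ω : ℝ) / n) ∂P =
      ((n : ℝ) - 1) / n * (a * b / ((a + b) * (a + b + 1))) := by
    intro i
    rw [(key i).2]
    obtain ⟨m, rfl⟩ : ∃ m, n = m + 2 := ⟨n - 2, by omega⟩
    have hs := bf_sum2 m ha hb
    rw [Finset.Nat.sum_antidiagonal_eq_sum_range_succ_mk] at hs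
    have hB := bf_pos ha hb
    have hr : betaFun (a + 1) (b + 1) = a * b / ((a + b) * (a + b + 1)) * betaFun a b := by
      rw [bf_left ha (by linarith), bf_right ha hb]
      field_simp
      ring
    rw [hr] at hs
    have : ∀ k ∈ Finset.range (m + 2 + 1),
        (P (X i ⁻¹' {k})).toReal * ((k : ℝ) / (m + 2 : ℕ) * (1 - (k : ℝ) / (m + 2 : ℕ))) =
        (((m + 2).choose k : ℝ) * (k * ((m + 2 - k : ℕ) : ℝ)) *
        betaFun (k + a) (((m + 2 - k : ℕ) : ℝ) + b)) * (1 / (betaFun a b * (m + 2) ^ 2)) := by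
      intro k hk
      have hk' : k ≤ m + 2 := by
        have := Finset.mem_range.1 hk
        omega
      rw [hdist, betaBinPMF, Nat.cast_sub hk']
      push_cast
      field_simp
    rw [Finset.sum_congr rfl this, ← Finset.sum_mul, hs]
    push_cast
    field_simp
    ring
  rw [integral_const_mul, integral_finsetSum _ (fun i _ => (key i).1), Finset.sum_congr rfl
    (fun i _ => hE i)]
  simp only [Finset.sum_const, Finset.card_univ, Fintype.card_fin, nsmul_eq_mul]
  have : (n : ℝ) - 1 ≠ 0 := by linarith
  field_simp
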